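/- arXiv:2507.13201 — 3 statements merged into one kernel-verified Lean document; each statement's English description precedes it below -/
import Mathlib

section
/- Let X be a locally compact Hausdorff space and let ω be a positive linear functional on the C*-algebra C₀(X, ℂ) of continuous complex-valued functions on X vanishing at infinity (pointwise operations, conjugation as involution, supremum norm) with operator norm ‖ω‖ = 1. Then there exists a unique regular Borel probability measure μ on X such that ω(f) = ∫_X f dμ for every f ∈ C₀(X, ℂ). -/
open ComplexOrder MeasureTheory ZeroAtInfty

open CompactlySupported

namespace ZeroAtInftyContinuousMap

variable {X : Type*} [TopologicalSpace X]

lemma norm_le_of_forall_norm_apply_le {E : Type*} [SeminormedAddCommGroup E] {f : C₀(X, E)}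
    {C : ℝ} (hC : 0 ≤ C) (h : ∀ x, ‖f x‖ ≤ C) : ‖f‖ ≤ C :=
  (BoundedContinuousFunction.norm_le (f := f.toBCF) hC).2 h

/-- Compactly supported continuous functions are dense in the functions vanishing at infinity. -/
lemma denseRange_compactlySupported [LocallyCompactSpace X] [T2Space X] {E : Type*}
    [NormedAddCommGroup E] [NormedSpace ℝ E] :
    DenseRange (fun g : C_c(X, E) ↦ (g : C₀(X, E))) := by
  intro f
  rw [Metric.mem_closure_iff]
  intro ε hε
  have hlim : ∀ᶠ x in Filter.cocompact X, ‖f x‖ < ε / 2 := by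
    have := (zero_at_infty f).norm
    rw [norm_zero] at this
    exact this.eventually (gt_mem_nhds (half_pos hε))
  obtain ⟨K, hK, hKf⟩ := Filter.mem_cocompact.1 hlim
  obtain ⟨φ, hφK, hφc, hφ⟩ :=
    exists_continuousMap_one_of_isCompact_subset_isOpen hK isOpen_univ (Set.subset_univ K)
  let g : C_c(X, E) :=
    ⟨⟨fun x ↦ φ x • f x, φ.continuous.smul (map_continuous f)⟩,
      (hasCompactSupport_def.mpr hφc).smul_right⟩
  refine ⟨_, ⟨g, rfl⟩, ?_⟩
  rw [dist_eq_norm]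
  refine (norm_le_of_forall_norm_apply_le (half_pos hε).le fun x ↦ ?_).trans_lt (half_lt_self hε)
  change ‖f x - φ x • f x‖ ≤ ε / 2
  by_cases hx : x ∈ K
  · rw [hφK hx]
    simpa using (half_pos hε).le
  · obtain ⟨h0, h1⟩ := hφ.2 x
    have h : f x - φ x • f x = (1 - φ x) • f x := by rw [sub_smul, one_smul]
    rw [h, norm_smul, Real.norm_of_nonneg (sub_nonneg.2 h1)]
    exact (mul_le_of_le_one_left (norm_nonneg _) (by linarith)).trans (hKf hx).le

lemma integrable [MeasurableSpace X] [OpensMeasurableSpace X] (f : C₀(X, ℂ)) (μ : Measure X)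
    [IsFiniteMeasure μ] : Integrable f μ :=
  f.toBCF.integrable μ

end ZeroAtInftyContinuousMap

namespace CompactlySupportedContinuousMap

variable {X : Type*} [TopologicalSpace X]

/-- The inclusion of real compactly supported functions into complex functions vanishing at
infinity. -/
noncomputable def toComplexZeroAtInfty : C_c(X, ℝ) →ₗ[ℝ] C₀(X, ℂ) where
  toFun f :=
    { toFun := fun x ↦ (f x : ℂ)
      continuous_toFun := Complex.continuous_ofReal.comp (map_continuous f)
      zero_at_infty' := (f.hasCompactSupport.comp_left Complex.ofReal_zero).is_zero_at_infty }
  map_add' f g := ZeroAtInftyContinuousMap.ext fun x ↦ Complex.ofReal_add (f x) (g x)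
  map_smul' c f := ZeroAtInftyContinuousMap.ext fun x ↦ by simp

@[simp]
lemma toComplexZeroAtInfty_apply (f : C_c(X, ℝ)) (x : X) :
    toComplexZeroAtInfty f x = (f x : ℂ) :=
  rfl

lemma toComplexZeroAtInfty_re_add_im (h : C_c(X, ℂ)) :
    toComplexZeroAtInfty (h.compLeft ⟨Complex.re, Complex.continuous_re⟩) +
      Complex.I • toComplexZeroAtInfty (h.compLeft ⟨Complex.im, Complex.continuous_im⟩) =
      (h : C₀(X, ℂ)) := by
  ext x
  change _ = h x
  simp [compLeft_apply, mul_comm Complex.I, Complex.re_add_im]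

lemma exists_toComplexZeroAtInfty_eq_star_mul_self {f : C_c(X, ℝ)} (hf : 0 ≤ f) :
    ∃ g : C₀(X, ℂ), toComplexZeroAtInfty f = star g * g := by
  refine ⟨toComplexZeroAtInfty (f.compLeft ⟨Real.sqrt, Real.continuous_sqrt⟩), ?_⟩
  ext x
  have hx : 0 ≤ f x := hf x
  simp [compLeft_apply, ← Complex.ofReal_mul, Real.mul_self_sqrt hx]

lemma integral_toComplexZeroAtInfty [MeasurableSpace X] (μ : Measure X) (f : C_c(X, ℝ)) :
    ∫ x, toComplexZeroAtInfty f x ∂μ = ((∫ x, f x ∂μ : ℝ) : ℂ) := by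
  simp_rw [toComplexZeroAtInfty_apply]
  exact integral_ofReal

end CompactlySupportedContinuousMap

section Functional

open CompactlySupportedContinuousMap

variable {X : Type*} [TopologicalSpace X] {ω : C₀(X, ℂ) →L[ℂ] ℂ}

lemma nonneg_toComplexZeroAtInfty_of_star_mul_self
    (hpos : ∀ f : C₀(X, ℂ), 0 ≤ ω (star f * f)) {f : C_c(X, ℝ)} (hf : 0 ≤ f) :
    0 ≤ ω (toComplexZeroAtInfty f) := by
  obtain ⟨g, hg⟩ := exists_toComplexZeroAtInfty_eq_star_mul_self hf
  exact hg ▸ hpos g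

lemma im_toComplexZeroAtInfty_eq_zero
    (hpos : ∀ f : C₀(X, ℂ), 0 ≤ ω (star f * f)) (f : C_c(X, ℝ)) :
    (ω (toComplexZeroAtInfty f)).im = 0 := by
  have him {g : C_c(X, ℝ)} (hg : 0 ≤ g) : (ω (toComplexZeroAtInfty g)).im = 0 :=
    (Complex.nonneg_iff.1 (nonneg_toComplexZeroAtInfty_of_star_mul_self hpos hg)).2.symm
  rw [← nnrealPart_sub_nnrealPart_neg f, map_sub, map_sub, Complex.sub_im,
    him toReal_nonneg, him toReal_nonneg, sub_zero]

/-- The positive functional on `C_c(X, ℝ)` obtained by restricting a positive functional on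
`C₀(X, ℂ)`. -/
noncomputable def restrictCompactlySupported (ω : C₀(X, ℂ) →L[ℂ] ℂ)
    (hpos : ∀ f : C₀(X, ℂ), 0 ≤ ω (star f * f)) : C_c(X, ℝ) →ₚ[ℝ] ℝ :=
  PositiveLinearMap.mk₀
    (Complex.reLm ∘ₗ ω.toLinearMap.restrictScalars ℝ ∘ₗ toComplexZeroAtInfty)
    fun _ hf ↦ (Complex.nonneg_iff.1 (nonneg_toComplexZeroAtInfty_of_star_mul_self hpos hf)).1

lemma ofReal_restrictCompactlySupported (hpos : ∀ f : C₀(X, ℂ), 0 ≤ ω (star f * f))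
    (f : C_c(X, ℝ)) :
    (restrictCompactlySupported ω hpos f : ℂ) = ω (toComplexZeroAtInfty f) :=
  Complex.ext rfl (im_toComplexZeroAtInfty_eq_zero hpos f).symm

variable [MeasurableSpace X] [BorelSpace X]

/-- A continuous functional on `C₀(X, ℂ)` that agrees with integration against a finite measure on
real compactly supported functions agrees with it everywhere. -/
lemma eq_integral_of_forall_toComplexZeroAtInfty [LocallyCompactSpace X] [T2Space X]
    {μ : Measure X} [IsFiniteMeasure μ]
    (h : ∀ f : C_c(X, ℝ), ω (toComplexZeroAtInfty f) = ∫ x, toComplexZeroAtInfty f x ∂μ)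
    (f : C₀(X, ℂ)) : ω f = ∫ x, f x ∂μ := by
  have hcont : Continuous fun f : C₀(X, ℂ) ↦ ∫ x, f x ∂μ := by
    have hL : Continuous fun f : BoundedContinuousFunction X ℂ ↦ ∫ x, f x ∂μ := by
      refine LipschitzWith.continuous (K := μ.real Set.univ |>.toNNReal) ?_
      refine LipschitzWith.of_dist_le_mul fun f g ↦ ?_
      rw [dist_eq_norm, dist_eq_norm, ← integral_sub (f.integrable μ) (g.integrable μ),
        Real.coe_toNNReal _ measureReal_nonneg]
      exact BoundedContinuousFunction.norm_integral_le_mul_norm μ (f - g)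
    exact hL.comp ZeroAtInftyContinuousMap.isometry_toBCF.continuous
  refine congrFun (ZeroAtInftyContinuousMap.denseRange_compactlySupported.equalizer
    ω.continuous hcont (funext fun g ↦ ?_)) f
  simp only [Function.comp_apply]
  rw [← toComplexZeroAtInfty_re_add_im g, map_add, map_smul, h, h, smul_eq_mul,
    ← integral_const_mul, ← integral_add]
  · rfl
  · exact ZeroAtInftyContinuousMap.integrable _ μ
  · exact (ZeroAtInftyContinuousMap.integrable _ μ).const_mul _

lemma norm_le_measureReal_univ_of_eq_integral {μ : Measure X} [IsFiniteMeasure μ]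
    (h : ∀ f : C₀(X, ℂ), ω f = ∫ x, f x ∂μ) : ‖ω‖ ≤ μ.real Set.univ := by
  refine ω.opNorm_le_bound measureReal_nonneg fun f ↦ ?_
  rw [h]
  exact BoundedContinuousFunction.norm_integral_le_mul_norm μ f.toBCF

lemma rieszMeasure_restrictCompactlySupported_univ_le [LocallyCompactSpace X] [T2Space X]
    (hpos : ∀ f : C₀(X, ℂ), 0 ≤ ω (star f * f)) :
    RealRMK.rieszMeasure (restrictCompactlySupported ω hpos) Set.univ ≤ ENNReal.ofReal ‖ω‖ := by
  rw [isOpen_univ.measure_eq_iSup_isCompact]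
  refine iSup₂_le fun K _ ↦ iSup_le fun hK ↦ ?_
  obtain ⟨φ, hφK, hφc, hφ⟩ :=
    exists_continuousMap_one_of_isCompact_subset_isOpen hK isOpen_univ (Set.subset_univ K)
  let f : C_c(X, ℝ) := ⟨φ, hasCompactSupport_def.mpr hφc⟩
  refine (RealRMK.rieszMeasure_le_of_eq_one _ (f := f) (fun x ↦ (hφ.2 x).1) hK hφK).trans
    (ENNReal.ofReal_le_ofReal ?_)
  have hf : ‖toComplexZeroAtInfty f‖ ≤ 1 := by
    refine ZeroAtInftyContinuousMap.norm_le_of_forall_norm_apply_le zero_le_one fun x ↦ ?_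
    rw [toComplexZeroAtInfty_apply, Complex.norm_of_nonneg (show 0 ≤ f x from (hφ.2 x).1)]
    exact (hφ.2 x).2
  exact (Complex.re_le_norm _).trans (ω.unit_le_opNorm _ hf)

end Functional

/-- Riesz–Markov representation for states on `C₀(X, ℂ)`: if `X` is a locally compact Hausdorff
space and `ω` is a positive linear functional of operator norm `1` on the C*-algebra
`C₀(X, ℂ)` of continuous complex functions vanishing at infinity, then there is a unique
regular Borel probability measure `μ` on `X` with `ω f = ∫ f dμ` for all `f ∈ C₀(X, ℂ)`. -/
theorem state_on_C0_eq_integral_regular_probability_measure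
    {X : Type*} [TopologicalSpace X] [LocallyCompactSpace X] [T2Space X]
    [MeasurableSpace X] [BorelSpace X]
    (ω : C₀(X, ℂ) →L[ℂ] ℂ)
    (hpos : ∀ f : C₀(X, ℂ), 0 ≤ ω (star f * f))
    (hnorm : ‖ω‖ = 1) :
    ∃! μ : Measure X, μ.Regular ∧ IsProbabilityMeasure μ ∧
      ∀ f : C₀(X, ℂ), ω f = ∫ x, f x ∂μ := by
  set μ := RealRMK.rieszMeasure (restrictCompactlySupported ω hpos)
  have hle : μ Set.univ ≤ 1 := by
    simpa [hnorm] using rieszMeasure_restrictCompactlySupported_univ_le hpos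
  have : IsFiniteMeasure μ := ⟨hle.trans_lt ENNReal.one_lt_top⟩
  have hμω : ∀ f : C₀(X, ℂ), ω f = ∫ x, f x ∂μ :=
    eq_integral_of_forall_toComplexZeroAtInfty fun f ↦ by
      rw [CompactlySupportedContinuousMap.integral_toComplexZeroAtInfty,
        RealRMK.integral_rieszMeasure, ofReal_restrictCompactlySupported]
  have hge : 1 ≤ μ Set.univ := by
    have h := norm_le_measureReal_univ_of_eq_integral hμω
    rw [hnorm] at h
    simpa using (ENNReal.ofReal_le_iff_le_toReal (measure_ne_top μ Set.univ)).2 h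
  refine ⟨μ, ⟨inferInstance, ⟨hle.antisymm hge⟩, hμω⟩, ?_⟩
  rintro ν ⟨_, _, hν⟩
  refine Measure.ext_of_integral_eq_on_compactlySupported fun f ↦ ?_
  rw [← Complex.ofReal_inj, ← CompactlySupportedContinuousMap.integral_toComplexZeroAtInfty,
    ← CompactlySupportedContinuousMap.integral_toComplexZeroAtInfty, ← hν, hμω]
end

section
/- Let X be a compact Hausdorff space and A a unital C*-algebra, and let C(X, A) be the unital C*-algebra of continuous A-valued functions on X with pointwise operations and supremum norm. If ω is a pure state on C(X, A), then there exist a point x ∈ X and a pure state ρ on A such that ω(f) = ρ(f(x)) for every f ∈ C(X, A). -/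
open ComplexOrder

/-- A positive linear functional on a (unital) C*-algebra `A`: `ψ (star a * a) ≥ 0`
(a nonnegative real, in the partial order on `ℂ`) for every `a`. -/
def IsPositiveFunctional (A : Type*) [CStarAlgebra A] (ψ : A →ₗ[ℂ] ℂ) : Prop :=
  ∀ a : A, 0 ≤ ψ (star a * a)

/-- A state on a unital C*-algebra `A`: a positive linear functional with `ω 1 = 1`. -/
def IsState (A : Type*) [CStarAlgebra A] (ω : A →ₗ[ℂ] ℂ) : Prop :=
  ω 1 = 1 ∧ IsPositiveFunctional A ω

/-- A state `ω` is pure if every positive linear functional `ψ` majorized by `ω`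
(i.e. such that `ω - ψ` is again positive) is of the form `ψ = λ • ω` with `0 ≤ λ ≤ 1`. -/
def IsPureState (A : Type*) [CStarAlgebra A] (ω : A →ₗ[ℂ] ℂ) : Prop :=
  IsState A ω ∧ ∀ ψ : A →ₗ[ℂ] ℂ, IsPositiveFunctional A ψ → IsPositiveFunctional A (ω - ψ) →
    ∃ l : ℝ, 0 ≤ l ∧ l ≤ 1 ∧ ψ = (l : ℂ) • ω

/-- Complex scalars and scalar functions act compatibly on vector-valued functions. -/
theorem ContinuousMap.smul_smul_eq {X E : Type*} [TopologicalSpace X] [NormedAddCommGroup E]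
    [NormedSpace ℂ E] (c : ℂ) (g : C(X, ℂ)) (f : C(X, E)) : (c • g) • f = c • g • f := by
  ext y
  simp [mul_smul]

/-- A positive functional stays nonnegative on `f⋆ f` multiplied by a nonnegative scalar function. -/
theorem IsPositiveFunctional.ofReal_smul_nonneg
    {X : Type*} [TopologicalSpace X] [CompactSpace X] {A : Type*} [CStarAlgebra A]
    {ω : C(X, A) →ₗ[ℂ] ℂ} (hω : IsPositiveFunctional C(X, A) ω)
    {g : C(X, ℂ)} {r : X → ℝ} (hr : Continuous r) (hr0 : ∀ y, 0 ≤ r y)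
    (hg : ∀ y, g y = (r y : ℂ)) (f : C(X, A)) : 0 ≤ ω (g • (star f * f)) := by
  let s : C(X, ℂ) := ⟨fun y => (Real.sqrt (r y) : ℂ), by fun_prop⟩
  have h : g • (star f * f) = star (s • f) * (s • f) := by
    ext y
    have hs : ((Real.sqrt (r y) : ℂ)) * (Real.sqrt (r y) : ℂ) = (r y : ℂ) := by
      rw [← Complex.ofReal_mul, Real.mul_self_sqrt (hr0 y)]
    simp only [ContinuousMap.smul_apply', ContinuousMap.mul_apply,
      ContinuousMap.star_apply, star_smul, smul_mul_smul_comm, ContinuousMap.coe_mk, s, hg,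
      RCLike.star_def, Complex.conj_ofReal, hs]
  rw [h]
  exact hω _

/-- A pure state on `C(X, A)` is multiplicative with respect to scalar functions. -/
theorem IsPureState.map_smul_eq_mul
    {X : Type*} [TopologicalSpace X] [CompactSpace X] {A : Type*} [CStarAlgebra A]
    {ω : C(X, A) →ₗ[ℂ] ℂ} (hω : IsPureState C(X, A) ω) (g : C(X, ℂ)) (f : C(X, A)) :
    ω (g • f) = ω (g • (1 : C(X, A))) * ω f := by
  have hg : g ∈ Submodule.span ℂ {a : C(X, ℂ) | 0 ≤ a} := by
    rw [CStarAlgebra.span_nonneg]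
    trivial
  induction hg using Submodule.span_induction with
  | zero => simp
  | add a b _ _ ha hb => simp [add_smul, ha, hb, add_mul]
  | smul c a _ ha => simp [ContinuousMap.smul_smul_eq, ha, mul_assoc]
  | mem p hp =>
    have hp0 (y : X) : 0 ≤ (p y).re := (Complex.nonneg_iff.1 (hp y)).1
    have hpr (y : X) : p y = ((p y).re : ℂ) := Complex.ext rfl (Complex.nonneg_iff.1 (hp y)).2.symm
    set c : ℝ := ‖p‖ + 1
    have hc : 0 < c := by positivity
    have hc' : (c : ℂ) ≠ 0 := by exact_mod_cast hc.ne'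
    have hpc (y : X) : (p y).re / c ≤ 1 := by
      rw [div_le_one hc]
      linarith [Complex.re_le_norm (p y), p.norm_coe_le_norm y]
    let q : C(X, ℂ) := (c : ℂ)⁻¹ • p
    have hq (y : X) : q y = (((p y).re / c : ℝ) : ℂ) := by
      simp only [q, ContinuousMap.smul_apply, smul_eq_mul, Complex.ofReal_div, ← hpr]
      field_simp
    let ψ : C(X, A) →ₗ[ℂ] ℂ :=
      { toFun := fun f => ω (q • f)
        map_add' := fun a b => by simp [smul_add]
        map_smul' := fun a b => by
          rw [show q • a • b = a • q • b by ext y; exact smul_comm (q y) a (b y), map_smul,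
            RingHom.id_apply] }
    have hψ (f : C(X, A)) : ψ f = (c : ℂ)⁻¹ * ω (p • f) := by simp [ψ, q, ContinuousMap.smul_smul_eq]
    obtain ⟨l, -, -, hl⟩ := hω.2 ψ
      (fun f => hω.1.2.ofReal_smul_nonneg (by fun_prop) (fun y => div_nonneg (hp0 y) hc.le) hq f)
      (fun f => by
        have := hω.1.2.ofReal_smul_nonneg (g := 1 - q) (r := fun y => 1 - (p y).re / c)
          (by fun_prop) (fun y => sub_nonneg.2 (hpc y)) (fun y => by simp [hq]) f
        simpa [sub_smul, ψ] using this)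
    have key (f : C(X, A)) : ω (p • f) = c * l * ω f := by
      have := hψ f
      rw [hl, LinearMap.smul_apply, smul_eq_mul] at this
      field_simp at this
      linear_combination -this
    rw [key f, key 1, hω.1.1, mul_one]

/-- A nonzero multiplicative linear functional on `C(X, ℂ)` is evaluation at a point. -/
theorem ContinuousMap.exists_algHom_eq_eval
    {X : Type*} [TopologicalSpace X] [CompactSpace X] [T2Space X] (φ : C(X, ℂ) →ₐ[ℂ] ℂ) :
    ∃ x : X, ∀ g, φ g = g x := by
  obtain ⟨x, hx⟩ := (WeakDual.CharacterSpace.continuousMapEval_bijective (X := X) (𝕜 := ℂ)).2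
    (WeakDual.CharacterSpace.equivAlgHom.symm φ)
  refine ⟨x, fun g => ?_⟩
  have := DFunLike.congr_fun hx g
  simpa using this.symm

/-- Every continuous function into a normed space is a scalar function, vanishing at the same
points, times another continuous function. -/
theorem ContinuousMap.exists_smul_eq
    {X E : Type*} [TopologicalSpace X] [NormedAddCommGroup E] [NormedSpace ℂ E] (f : C(X, E)) :
    ∃ (g : C(X, ℂ)) (k : C(X, E)), g • k = f ∧ ∀ x, f x = 0 → g x = 0 := by
  let s : X → ℝ := fun y => Real.sqrt ‖f y‖
  have hs : Continuous s := by fun_prop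
  have hs0 (y : X) : s y = 0 ↔ f y = 0 := by simp [s, Real.sqrt_eq_zero]
  have hk : Continuous fun y => ((s y : ℂ)⁻¹) • f y := by
    refine continuous_iff_continuousAt.2 fun x => ?_
    by_cases hx : f x = 0
    · have hnorm (y : X) : ‖((s y : ℂ)⁻¹) • f y‖ = s y := by
        rw [norm_smul, norm_inv, Complex.norm_real, Real.norm_of_nonneg (Real.sqrt_nonneg _)]
        by_cases hy : f y = 0
        · simp [s, hy]
        · have : s y ≠ 0 := mt (hs0 y).1 hy
          have hss : s y * s y = ‖f y‖ := Real.mul_self_sqrt (norm_nonneg (f y))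
          change (s y)⁻¹ * ‖f y‖ = s y
          rw [← hss, inv_mul_cancel_left₀ this]
      have h0 : Filter.Tendsto s (nhds x) (nhds 0) := by
        simpa [(hs0 x).2 hx] using hs.tendsto x
      simpa [ContinuousAt, hx] using squeeze_zero_norm (fun y => (hnorm y).le) h0
    · have : (s x : ℂ) ≠ 0 := by exact_mod_cast mt (hs0 x).1 hx
      exact ((Complex.continuous_ofReal.comp hs).continuousAt.inv₀ this).smul
        f.continuous.continuousAt
  refine ⟨⟨fun y => (s y : ℂ), by fun_prop⟩, ⟨_, hk⟩, ?_, fun x hx => ?_⟩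
  · ext y
    by_cases hy : f y = 0
    · simp [hy]
    · have : (s y : ℂ) ≠ 0 := by exact_mod_cast mt (hs0 y).1 hy
      simp [smul_smul, this]
  · simp [(hs0 x).2 hx]

/-- Every pure state on `C(X, A)`, with `X` compact Hausdorff and `A` a unital C*-algebra
(so `C(X, A) ≅ C(X, ℂ) ⊗ A` is the tensor product of a commutative unital C*-algebra with a
unital C*-algebra), is a product state: there are a point `x ∈ X` and a pure state `ρ` on `A`
with `ω f = ρ (f x)` for all `f`. -/
theorem pure_state_on_continuous_functions_is_product
    {X : Type*} [TopologicalSpace X] [CompactSpace X] [T2Space X]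
    {A : Type*} [CStarAlgebra A]
    (ω : C(X, A) →ₗ[ℂ] ℂ) (hω : IsPureState C(X, A) ω) :
    ∃ (x : X) (ρ : A →ₗ[ℂ] ℂ), IsPureState A ρ ∧ ∀ f : C(X, A), ω f = ρ (f x) := by
  let φ : C(X, ℂ) →ₐ[ℂ] ℂ := AlgHom.ofLinearMap
    { toFun := fun g => ω (g • (1 : C(X, A)))
      map_add' := fun a b => by simp [add_smul]
      map_smul' := fun a b => by simp [ContinuousMap.smul_smul_eq] }
    (by simpa using hω.1.1)
    (fun a b => by
      simpa [mul_smul] using hω.map_smul_eq_mul a (b • (1 : C(X, A))))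
  obtain ⟨x, hx⟩ := ContinuousMap.exists_algHom_eq_eval φ
  have hvanish (f : C(X, A)) (hf : f x = 0) : ω f = 0 := by
    obtain ⟨g, k, rfl, hg⟩ := ContinuousMap.exists_smul_eq f
    have : ω (g • (1 : C(X, A))) = 0 := (hx g).trans (hg x hf)
    rw [hω.map_smul_eq_mul, this, zero_mul]
  let ρ : A →ₗ[ℂ] ℂ :=
    { toFun := fun a => ω (ContinuousMap.const X a)
      map_add' := fun a b => (congrArg ω (by ext; simp)).trans (map_add ω _ _)
      map_smul' := fun c a => (congrArg ω (by ext; simp)).trans (map_smul ω _ _) }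
  have hρ (f : C(X, A)) : ω f = ρ (f x) := by
    have := hvanish (f - ContinuousMap.const X (f x)) (by simp)
    rwa [map_sub, sub_eq_zero] at this
  refine ⟨x, ρ, ⟨⟨hω.1.1, fun a => ?_⟩, fun ψ hψ hρψ => ?_⟩, hρ⟩
  · simpa [hρ] using hω.1.2 (ContinuousMap.const X a)
  · let ψ' : C(X, A) →ₗ[ℂ] ℂ :=
      { toFun := fun f => ψ (f x)
        map_add' := fun a b => by simp
        map_smul' := fun c a => by simp }
    obtain ⟨l, hl0, hl1, hl⟩ := hω.2 ψ' (fun f => hψ (f x))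
      (fun f => by simpa [hρ, ψ'] using hρψ (f x))
    exact ⟨l, hl0, hl1, LinearMap.ext fun a =>
      LinearMap.congr_fun hl (ContinuousMap.const X a)⟩
end

section
/- Let X be a compact Hausdorff space and A a unital C*-algebra, and let C(X, A) be the unital C*-algebra of continuous A-valued functions on X with pointwise operations and supremum norm. For every x ∈ X and every pure state ρ on A, the functional ω : C(X, A) → ℂ defined by ω(f) = ρ(f(x)) is a pure state on C(X, A). -/
open ComplexOrder

/-- A positive functional vanishes on every `a` with `ψ (star a * a) = 0`. -/
theorem IsPositiveFunctional.eq_zero_of_star_mul_self {A : Type*} [CStarAlgebra A]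
    {ψ : A →ₗ[ℂ] ℂ} (hψ : IsPositiveFunctional A ψ) {a : A} (ha : ψ (star a * a) = 0) :
    ψ a = 0 := by
  have expand (c : ℂ) : 0 ≤ ψ 1 + c * ψ a + star c * ψ (star a) := by
    have h := hψ (1 + c • a)
    have e : star (1 + c • a) * (1 + c • a)
        = 1 + c • a + star c • star a + (star c * c) • (star a * a) := by
      simp only [star_add, star_one, star_smul, add_mul, mul_add, one_mul, mul_one,
        smul_mul_smul_comm]
      abel
    rw [e] at h
    simpa [ha] using h
  have h0 : 0 ≤ (ψ 1).re ∧ 0 = (ψ 1).im := by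
    simpa [Complex.le_def] using expand 0
  have hre (t : ℝ) := (Complex.le_def.1 (expand t)).1
  have hreI (t : ℝ) := (Complex.le_def.1 (expand (t * Complex.I))).1
  have him := (Complex.le_def.1 (expand 1)).2
  have himI := (Complex.le_def.1 (expand Complex.I)).2
  have lin (p q : ℝ) (h : ∀ t : ℝ, 0 ≤ p + t * q) : q = 0 := by
    by_contra hq
    have := h (-(p + 1) / q)
    rw [div_mul_cancel₀ _ hq] at this
    linarith
  have k1 := lin (ψ 1).re ((ψ a).re + (ψ (star a)).re) fun t ↦ by
    have := hre t
    simp at this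
    linarith
  have k2 := lin (ψ 1).re (-(ψ a).im + (ψ (star a)).im) fun t ↦ by
    have := hreI t
    simp at this
    linarith
  simp at him himI
  apply Complex.ext <;> simp <;> linarith [h0.2]

/-- For `X` compact Hausdorff, `A` a unital C*-algebra, `x ∈ X` and `ρ` a pure state on `A`,
the functional `f ↦ ρ (f x)` is a (complex-linear) pure state on `C(X, A)`
(`≅ C(X, ℂ) ⊗ A`). -/
theorem product_state_is_pure_state_on_continuous_functions
    {X : Type*} [TopologicalSpace X] [CompactSpace X] [T2Space X]
    {A : Type*} [CStarAlgebra A]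
    (x : X) (ρ : A →ₗ[ℂ] ℂ) (hρ : IsPureState A ρ) :
    ∃ ω : C(X, A) →ₗ[ℂ] ℂ,
      (∀ f : C(X, A), ω f = ρ (f x)) ∧ IsPureState C(X, A) ω := by
  obtain ⟨⟨hρ1, hρpos⟩, hpure⟩ := hρ
  let ev : C(X, A) →ₗ[ℂ] A :=
    { toFun := fun f ↦ f x, map_add' := fun _ _ ↦ rfl, map_smul' := fun _ _ ↦ rfl }
  let const : A →ₗ[ℂ] C(X, A) :=
    { toFun := ContinuousMap.const X, map_add' := fun _ _ ↦ rfl, map_smul' := fun _ _ ↦ rfl }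
  refine ⟨ρ ∘ₗ ev, fun _ ↦ rfl, ⟨hρ1, fun f ↦ hρpos (f x)⟩, fun ψ hψ hle ↦ ?_⟩
  have vanish (f : C(X, A)) (hf : f x = 0) : ψ f = 0 := by
    refine hψ.eq_zero_of_star_mul_self (le_antisymm ?_ (hψ f))
    have h : 0 ≤ ρ (star (f x) * f x) - ψ (star f * f) := hle f
    simpa [hf] using h
  have factor (f : C(X, A)) : ψ f = ψ (const (f x)) := by
    rw [← sub_eq_zero, ← map_sub]
    exact vanish _ (sub_self (f x))
  obtain ⟨l, hl0, hl1, hl⟩ := hpure (ψ ∘ₗ const) (fun a ↦ hψ (const a)) (fun a ↦ hle (const a))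
  exact ⟨l, hl0, hl1, LinearMap.ext fun f ↦ (factor f).trans (LinearMap.congr_fun hl (f x))⟩
end
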